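/- Let a, b > 0, δ ∈ ℝ, (x₀, y₀) ∈ ℝ², and φ ∈ ℝ. Define the attenuation function f : ℝ² → ℝ of the ellipse with center (x₀,y₀), semi-axes a and b, rotation angle φ, and attenuation δ by f(x,y) = δ if x̂²/a² + ŷ²/b² ≤ 1 and f(x,y) = 0 otherwise, where x̂ = (x−x₀)cos φ + (y−y₀)sin φ and ŷ = (y−y₀)cos φ − (x−x₀)sin φ. Then for all t, θ ∈ ℝ, setting θ̂ = θ − φ and t̂ = t − x₀ cos θ − y₀ sin θ, the Radon transform of f satisfies: Rf(t,θ) = δ · 2ab·√(b² sin² θ̂ + a² cos² θ̂ − t̂²)/(b² sin² θ̂ + a² cos² θ̂) if t̂² ≤ b² sin² θ̂ + a² cos² θ̂, and Rf(t,θ) = 0 otherwise. -/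

import Mathlib

open Real MeasureTheory

/-- The Radon transform of `f : ℝ² → ℝ` (in curried form):
`Rf(t,θ) = ∫ s, f(t cos θ − s sin θ, t sin θ + s cos θ)`. -/
noncomputable def radonTransform (f : ℝ → ℝ → ℝ) (t θ : ℝ) : ℝ :=
  ∫ s : ℝ, f (t * Real.cos θ - s * Real.sin θ) (t * Real.sin θ + s * Real.cos θ)

/-- The set where the square of a nonconstant affine function is at most `q` has length
`2 * √q / D` (which vanishes when `q < 0`). -/
theorem integral_ite_affine_sq_le {D : ℝ} (hD : 0 < D) (c q δ : ℝ) :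
    ∫ s : ℝ, (if (D * s + c) ^ 2 ≤ q then δ else 0) = δ * (2 * √q) / D := by
  rcases lt_or_ge q 0 with hq | hq
  · have h (s : ℝ) : ¬ (D * s + c) ^ 2 ≤ q := by nlinarith [sq_nonneg (D * s + c)]
    simp [h, Real.sqrt_eq_zero_of_nonpos hq.le]
  · have h : (fun s : ℝ => if (D * s + c) ^ 2 ≤ q then δ else 0) =
        (Set.Icc ((-√q - c) / D) ((√q - c) / D)).indicator fun _ => δ := by
      classical
      ext s
      rw [Set.indicator_apply]
      refine if_congr ?_ rfl rfl
      rw [Real.sq_le hq, Set.mem_Icc, div_le_iff₀ hD, le_div_iff₀ hD]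
      constructor <;> rintro ⟨h₁, h₂⟩ <;> constructor <;> linarith
    have hle : (-√q - c) / D ≤ (√q - c) / D := by
      gcongr
      linarith [Real.sqrt_nonneg q]
    rw [h, integral_indicator_const _ measurableSet_Icc, Real.volume_real_Icc_of_le hle,
      smul_eq_mul]
    field_simp
    ring

/-- The coefficient `b² sin² θ + a² cos² θ` is positive. -/
theorem ellipse_width_sq_pos {a b : ℝ} (ha : 0 < a) (hb : 0 < b) (θ : ℝ) :
    0 < b ^ 2 * Real.sin θ ^ 2 + a ^ 2 * Real.cos θ ^ 2 := by
  rcases eq_or_ne (Real.cos θ) 0 with h | h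
  · have hs : Real.sin θ ^ 2 = 1 := by simpa [h] using Real.sin_sq_add_cos_sq θ
    rw [h, hs]
    positivity
  · positivity

/-- On the line with signed distance `u` and unit normal `(C, S)`, with parameter `w`, membership
in the axis-parallel centered ellipse is a bound on the square of an affine function of `w`. -/
theorem ellipse_line_iff {a b u w C S : ℝ} (ha : 0 < a) (hb : 0 < b) (hCS : S ^ 2 + C ^ 2 = 1)
    (hD : 0 < b ^ 2 * S ^ 2 + a ^ 2 * C ^ 2) :
    (u * C - w * S) ^ 2 / a ^ 2 + (u * S + w * C) ^ 2 / b ^ 2 ≤ 1 ↔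
      ((b ^ 2 * S ^ 2 + a ^ 2 * C ^ 2) * w + u * S * C * (a ^ 2 - b ^ 2)) ^ 2 ≤
        (a * b) ^ 2 * (b ^ 2 * S ^ 2 + a ^ 2 * C ^ 2 - u ^ 2) := by
  have key : (b ^ 2 * S ^ 2 + a ^ 2 * C ^ 2) *
        ((u * C - w * S) ^ 2 * b ^ 2 + a ^ 2 * (u * S + w * C) ^ 2) =
      ((b ^ 2 * S ^ 2 + a ^ 2 * C ^ 2) * w + u * S * C * (a ^ 2 - b ^ 2)) ^ 2 +
        (a * b) ^ 2 * u ^ 2 := by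
    linear_combination (a * b) ^ 2 * u ^ 2 * (S ^ 2 + C ^ 2 + 1) * hCS
  rw [div_add_div _ _ (by positivity) (by positivity), div_le_one (by positivity),
    ← mul_le_mul_iff_right₀ hD, key]
  constructor <;> intro h <;> linarith

/-- Radon transform of the attenuation function of a general (rotated, translated) ellipse. -/
theorem radon_ellipse_general (a b δ x₀ y₀ φ : ℝ) (ha : 0 < a) (hb : 0 < b)
    (f : ℝ → ℝ → ℝ)
    (hf : ∀ x y : ℝ, f x y =
      if ((x - x₀) * Real.cos φ + (y - y₀) * Real.sin φ) ^ 2 / a ^ 2 +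
          ((y - y₀) * Real.cos φ - (x - x₀) * Real.sin φ) ^ 2 / b ^ 2 ≤ 1
      then δ else 0) :
    ∀ t θ : ℝ,
      radonTransform f t θ =
        if (t - x₀ * Real.cos θ - y₀ * Real.sin θ) ^ 2 ≤
            b ^ 2 * Real.sin (θ - φ) ^ 2 + a ^ 2 * Real.cos (θ - φ) ^ 2
        then δ * (2 * a * b *
            Real.sqrt (b ^ 2 * Real.sin (θ - φ) ^ 2 + a ^ 2 * Real.cos (θ - φ) ^ 2 -
              (t - x₀ * Real.cos θ - y₀ * Real.sin θ) ^ 2)) /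
          (b ^ 2 * Real.sin (θ - φ) ^ 2 + a ^ 2 * Real.cos (θ - φ) ^ 2)
        else 0 := by
  intro t θ
  set u := t - x₀ * Real.cos θ - y₀ * Real.sin θ with hu
  have hD := ellipse_width_sq_pos ha hb (θ - φ)
  have hCS := Real.sin_sq_add_cos_sq (θ - φ)
  set D := b ^ 2 * Real.sin (θ - φ) ^ 2 + a ^ 2 * Real.cos (θ - φ) ^ 2 with hDdef
  set m := x₀ * Real.sin θ - y₀ * Real.cos θ with hm
  have hint (s : ℝ) :
      f (t * Real.cos θ - s * Real.sin θ) (t * Real.sin θ + s * Real.cos θ) =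
        if (D * s + (D * m + u * Real.sin (θ - φ) * Real.cos (θ - φ) * (a ^ 2 - b ^ 2))) ^ 2 ≤
          (a * b) ^ 2 * (D - u ^ 2) then δ else 0 := by
    have hθ := Real.sin_sq_add_cos_sq θ
    have hx : t * Real.cos θ - s * Real.sin θ - x₀ =
        u * Real.cos θ - (s + m) * Real.sin θ := by
      rw [hu, hm]
      linear_combination x₀ * hθ
    have hy : t * Real.sin θ + s * Real.cos θ - y₀ =
        u * Real.sin θ + (s + m) * Real.cos θ := by
      rw [hu, hm]
      linear_combination y₀ * hθ
    rw [hf, hx, hy]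
    refine if_congr ?_ rfl rfl
    rw [← add_assoc, ← mul_add, hDdef, ← ellipse_line_iff ha hb hCS hD, Real.sin_sub,
      Real.cos_sub]
    ring_nf
  rw [radonTransform]
  simp only [hint]
  rw [integral_ite_affine_sq_le hD, Real.sqrt_mul (sq_nonneg _), Real.sqrt_sq (by positivity)]
  split_ifs with h
  · ring
  · rw [Real.sqrt_eq_zero_of_nonpos (by linarith)]
    simp
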